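/- Let n ≥ 2 and let A be a Banach algebra without an identity element. If M ⊊ A is a subalgebra such that A^{n+1} ⊆ M, where A^{n+1} denotes the linear span of all products of n+1 elements of A, then M is an n-subideal of A. If moreover M is closed in A, then M is a closed n-subideal of A. -/

import Mathlib

open Filter Topology

noncomputable section

/-- `J` is a two-sided ideal of the subalgebra `I`. -/
def IsIdealOf {𝕜 A : Type*} [CommSemiring 𝕜] [NonUnitalNonAssocSemiring A] [Module 𝕜 A]
    (J I : NonUnitalSubalgebra 𝕜 A) : Prop :=
  (J : Set A) ⊆ (I : Set A) ∧ ∀ a ∈ I, ∀ x ∈ J, a * x ∈ J ∧ x * a ∈ J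

/-- The set `S` is an `n`-subideal of the algebra `A`. -/
def IsNSubideal (𝕜 : Type*) {A : Type*} [CommSemiring 𝕜] [NonUnitalNonAssocSemiring A]
    [Module 𝕜 A] (n : ℕ) (S : Set A) : Prop :=
  ∃ C : ℕ → NonUnitalSubalgebra 𝕜 A, (C 0 : Set A) = Set.univ ∧ (C n : Set A) = S ∧
    ∀ k < n, IsIdealOf (C (k + 1)) (C k)

/-- The set `S` is a closed `n`-subideal of the algebra `A`. -/
def IsClosedNSubideal (𝕜 : Type*) {A : Type*} [CommSemiring 𝕜] [NonUnitalNonAssocSemiring A]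
    [Module 𝕜 A] [TopologicalSpace A] (n : ℕ) (S : Set A) : Prop :=
  ∃ C : ℕ → NonUnitalSubalgebra 𝕜 A, (C 0 : Set A) = Set.univ ∧ (C n : Set A) = S ∧
    (∀ k ≤ n, IsClosed (C k : Set A)) ∧ ∀ k < n, IsIdealOf (C (k + 1)) (C k)

/-- Products of `n + 1` elements of the set `S`. -/
def prodsOf {A : Type*} [Mul A] (S : Set A) : ℕ → Set A
  | 0 => S
  | n + 1 => {x | ∃ y ∈ prodsOf S n, ∃ s ∈ S, x = y * s}

section PowSpan

variable (𝕜 : Type*) {A : Type*} [CommSemiring 𝕜] [NonUnitalSemiring A] [Module 𝕜 A]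

theorem prodsOf_univ_succ_subset {A : Type*} [Mul A] (k : ℕ) :
    prodsOf (Set.univ : Set A) (k + 1) ⊆ prodsOf Set.univ k := by
  induction k with
  | zero => exact Set.subset_univ _
  | succ k ih =>
    rintro _ ⟨y, hy, s, hs, rfl⟩
    exact ⟨y, ih hy, s, hs, rfl⟩

theorem mul_mem_prodsOf_univ_succ {A : Type*} [Semigroup A] (a : A) {k : ℕ} {x : A}
    (hx : x ∈ prodsOf Set.univ k) : a * x ∈ prodsOf Set.univ (k + 1) := by
  induction k generalizing x with
  | zero => exact ⟨a, Set.mem_univ _, x, Set.mem_univ _, rfl⟩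
  | succ k ih =>
    obtain ⟨y, hy, s, hs, rfl⟩ := hx
    exact ⟨a * y, ih hy, s, hs, (mul_assoc a y s).symm⟩

theorem span_prodsOf_univ_succ_le (k : ℕ) :
    Submodule.span 𝕜 (prodsOf (Set.univ : Set A) (k + 1)) ≤
      Submodule.span 𝕜 (prodsOf Set.univ k) :=
  Submodule.span_mono (prodsOf_univ_succ_subset k)

theorem mul_mem_span_prodsOf_univ_succ [SMulCommClass 𝕜 A A] (a : A) {k : ℕ} {x : A}
    (hx : x ∈ Submodule.span 𝕜 (prodsOf Set.univ k)) :
    a * x ∈ Submodule.span 𝕜 (prodsOf Set.univ (k + 1)) := by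
  induction hx using Submodule.span_induction with
  | mem x hx => exact Submodule.subset_span (mul_mem_prodsOf_univ_succ a hx)
  | zero => simp
  | add x y _ _ hx hy => rw [mul_add]; exact add_mem hx hy
  | smul c x _ hx => rw [mul_smul_comm]; exact Submodule.smul_mem _ c hx

theorem mem_span_prodsOf_univ_succ_mul [IsScalarTower 𝕜 A A] (a : A) {k : ℕ} {x : A}
    (hx : x ∈ Submodule.span 𝕜 (prodsOf Set.univ k)) :
    x * a ∈ Submodule.span 𝕜 (prodsOf Set.univ (k + 1)) := by
  induction hx using Submodule.span_induction with
  | mem x hx => exact Submodule.subset_span ⟨x, hx, a, Set.mem_univ _, rfl⟩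
  | zero => simp
  | add x y _ _ hx hy => rw [add_mul]; exact add_mem hx hy
  | smul c x _ hx => rw [smul_mul_assoc]; exact Submodule.smul_mem _ c hx

variable {𝕜} [IsScalarTower 𝕜 A A] [SMulCommClass 𝕜 A A] (M : NonUnitalSubalgebra 𝕜 A)

theorem mul_mem_sup_span_prodsOf_univ_succ {k : ℕ} {a b : A}
    (ha : a ∈ M.toSubmodule ⊔ Submodule.span 𝕜 (prodsOf Set.univ k))
    (hb : b ∈ M.toSubmodule ⊔ Submodule.span 𝕜 (prodsOf Set.univ k)) :
    a * b ∈ M.toSubmodule ⊔ Submodule.span 𝕜 (prodsOf Set.univ (k + 1)) := by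
  obtain ⟨m, hm, p, hp, rfl⟩ := Submodule.mem_sup.1 ha
  obtain ⟨m', hm', q, hq, rfl⟩ := Submodule.mem_sup.1 hb
  refine Submodule.mem_sup.2 ⟨m * m', M.mul_mem hm hm', p * m' + (m + p) * q,
    add_mem (mem_span_prodsOf_univ_succ_mul 𝕜 m' hp)
      (mul_mem_span_prodsOf_univ_succ 𝕜 (m + p) hq), ?_⟩
  rw [mul_add, add_mul m p m', add_assoc]

/-- The subalgebra `M + A ^ (k + 1)`. -/
def NonUnitalSubalgebra.supPow (k : ℕ) : NonUnitalSubalgebra 𝕜 A where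
  __ := M.toSubmodule ⊔ Submodule.span 𝕜 (prodsOf Set.univ k)
  mul_mem' ha hb := (sup_le_sup_left (span_prodsOf_univ_succ_le 𝕜 k) M.toSubmodule :)
    (mul_mem_sup_span_prodsOf_univ_succ M ha hb)

theorem NonUnitalSubalgebra.coe_supPow_zero : (M.supPow 0 : Set A) = Set.univ :=
  Set.eq_univ_of_forall fun x =>
    Submodule.mem_sup_right (S := M.toSubmodule) (Submodule.subset_span (Set.mem_univ x))

theorem NonUnitalSubalgebra.supPow_eq_self {n : ℕ}
    (h : (Submodule.span 𝕜 (prodsOf (Set.univ : Set A) n) : Set A) ⊆ M) : M.supPow n = M :=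
  SetLike.coe_injective <| congrArg (fun S : Submodule 𝕜 A => (S : Set A)) <|
    sup_eq_left.2 (show _ ≤ M.toSubmodule from h)

theorem NonUnitalSubalgebra.isIdealOf_supPow (k : ℕ) :
    IsIdealOf (M.supPow (k + 1)) (M.supPow k) := by
  have hle := sup_le_sup_left (span_prodsOf_univ_succ_le (A := A) 𝕜 k) M.toSubmodule
  exact ⟨hle, fun a ha x hx => ⟨mul_mem_sup_span_prodsOf_univ_succ M ha (hle hx),
    mul_mem_sup_span_prodsOf_univ_succ M (hle hx) ha⟩⟩

end PowSpan

theorem IsIdealOf.topologicalClosure {𝕜 A : Type*} [CommSemiring 𝕜] [NonUnitalSemiring A]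
    [Module 𝕜 A] [TopologicalSpace A] [IsTopologicalSemiring A] [ContinuousConstSMul 𝕜 A]
    {J I : NonUnitalSubalgebra 𝕜 A} (h : IsIdealOf J I) :
    IsIdealOf J.topologicalClosure I.topologicalClosure :=
  ⟨closure_mono h.1, fun _ ha _ hx =>
    ⟨map_mem_closure₂ continuous_mul ha hx fun a ha x hx => (h.2 a ha x hx).1,
      map_mem_closure₂ continuous_mul hx ha fun x hx a ha => (h.2 a ha x hx).2⟩⟩

/-- Let `n ≥ 2` and let `A` be a Banach algebra without an identity
element.  If `M ⊊ A` is a subalgebra with `A^{n+1} ⊆ M` (where `A^{n+1}` is the linear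
span of all products of `n + 1` elements of `A`), then `M` is an `n`-subideal of `A`; if
moreover `M` is closed in `A`, then `M` is a closed `n`-subideal of `A`. -/
theorem nsubideal_of_pow_subset
    {𝕜 A : Type*} [RCLike 𝕜] [NonUnitalNormedRing A] [NormedSpace 𝕜 A]
    [IsScalarTower 𝕜 A A] [SMulCommClass 𝕜 A A] [CompleteSpace A]
    (hnounit : ¬∃ e : A, ∀ x : A, e * x = x ∧ x * e = x)
    (n : ℕ) (hn : 2 ≤ n)
    (M : NonUnitalSubalgebra 𝕜 A) (hMproper : (M : Set A) ≠ Set.univ)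
    (hpow : ((Submodule.span 𝕜 (prodsOf (Set.univ : Set A) n) : Submodule 𝕜 A) : Set A) ⊆
      (M : Set A)) :
    IsNSubideal 𝕜 n (M : Set A) ∧
      (IsClosed (M : Set A) → IsClosedNSubideal 𝕜 n (M : Set A)) := by
  have hM := M.supPow_eq_self hpow
  refine ⟨⟨M.supPow, M.coe_supPow_zero, congrArg _ hM, fun k _ => M.isIdealOf_supPow k⟩,
    fun hclosed => ⟨fun k => (M.supPow k).topologicalClosure, ?_, ?_,
      fun k _ => isClosed_closure, fun k _ => (M.isIdealOf_supPow k).topologicalClosure⟩⟩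
  · exact (congrArg closure M.coe_supPow_zero).trans closure_univ
  · exact (congrArg (fun S : NonUnitalSubalgebra 𝕜 A => closure (S : Set A)) hM).trans
      hclosed.closure_eq

end
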